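/- Let A(Γ) act without inversions on a simplicial tree T with all edge stabilizers abelian, suppose v ∈ V(Γ) acts hyperbolically on T, and suppose Γ∖star(v) is nonempty. Then the set {u ∈ link(v) : u acts elliptically on T} separates v from Γ∖star(v) in Γ; that is, every path in Γ from v to a vertex outside star(v) passes through an elliptic vertex of link(v). -/

import Mathlib

/-- The relators of the right-angled Artin group of a graph `Γ`: one commutator
relator for each pair of adjacent vertices. -/
def raagRels {V : Type} (Γ : SimpleGraph V) : Set (FreeGroup V) :=
  {r | ∃ u v : V, Γ.Adj u v ∧
    r = FreeGroup.of u * FreeGroup.of v * (FreeGroup.of u)⁻¹ * (FreeGroup.of v)⁻¹}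

/-- The right-angled Artin group `A(Γ)` of a graph `Γ`. -/
abbrev RAAG {V : Type} (Γ : SimpleGraph V) : Type := PresentedGroup (raagRels Γ)

/-- The generator of `RAAG Γ` corresponding to a vertex `v`. -/
def RAAG.gen {V : Type} (Γ : SimpleGraph V) (v : V) : RAAG Γ := PresentedGroup.of v

section Action

variable {G W : Type} [Group G]

/-- The homomorphism `φ : G →* Equiv.Perm W` acts by automorphisms of the graph `T`. -/
def PreservesAdj (T : SimpleGraph W) (φ : G →* Equiv.Perm W) : Prop :=
  ∀ (g : G) (u v : W), T.Adj u v → T.Adj (φ g u) (φ g v)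

/-- The action `φ` on the graph `T` is without edge inversions. -/
def NoInversions (T : SimpleGraph W) (φ : G →* Equiv.Perm W) : Prop :=
  ∀ (g : G) (u v : W), T.Adj u v → ¬(φ g u = v ∧ φ g v = u)

/-- All edge stabilizers of the action `φ` on the graph `T` are abelian: any two
elements fixing both endpoints of an edge commute. -/
def AbelianEdgeStabilizers (T : SimpleGraph W) (φ : G →* Equiv.Perm W) : Prop :=
  ∀ u v : W, T.Adj u v → ∀ g h : G,
    φ g u = u → φ g v = v → φ h u = u → φ h v = v → g * h = h * g

/-- An element `g` is elliptic for the action `φ` if it fixes some vertex. -/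
def Elliptic (φ : G →* Equiv.Perm W) (g : G) : Prop := ∃ w : W, φ g w = w

/-- The action `φ` has a global fixed vertex. -/
def HasGlobalFixedVertex (φ : G →* Equiv.Perm W) : Prop := ∃ w : W, ∀ g : G, φ g w = w

end Action

/-- `K` is a separating clique of `Γ`: a clique whose removal disconnects `Γ`. -/
def SeparatingClique {V : Type} (Γ : SimpleGraph V) (K : Set V) : Prop :=
  Γ.IsClique K ∧ ∃ x y : ↥(Kᶜ), ¬ (Γ.induce Kᶜ).Reachable x y

namespace SimpleGraph

variable {W : Type} {T : SimpleGraph W}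

/-- The vertex `q` is a neighbour of `p` lying one step closer to `z`. -/
def StepToward (T : SimpleGraph W) (p q z : W) : Prop :=
  T.Adj p q ∧ T.dist p z = T.dist q z + 1

theorem StepToward.adj {p q z : W} (h : T.StepToward p q z) : T.Adj p q := h.1

theorem StepToward.dist_eq {p q z : W} (h : T.StepToward p q z) :
    T.dist p z = T.dist q z + 1 := h.2

theorem StepToward.ne {p q z : W} (h : T.StepToward p q z) : p ≠ z := by
  rintro rfl
  have := h.dist_eq
  simp at this

theorem Connected.exists_stepToward (hT : T.Connected) {p z : W} (h : p ≠ z) :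
    ∃ q, T.StepToward p q z := by
  obtain ⟨w, hw⟩ := hT.exists_walk_length_eq_dist p z
  cases w with
  | nil => exact absurd rfl h
  | @cons _ q _ hpq w =>
    refine ⟨q, hpq, ?_⟩
    have h1 := dist_le w
    have h2 := hT.dist_triangle (u := p) (v := q) (w := z)
    have h3 := dist_eq_one_iff_adj.mpr hpq
    simp only [Walk.length_cons] at hw
    omega

namespace IsTree

theorem stepToward_or (hT : T.IsTree) {p q : W} (h : T.Adj p q) (z : W) :
    T.StepToward p q z ∨ T.StepToward q p z := by
  have h1 := hT.dist_eq_dist_add_one_of_adj z h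
  rw [dist_comm (u := z), dist_comm (u := z)] at h1
  exact h1.imp (fun h1 => ⟨h, h1⟩) (fun h1 => ⟨h.symm, h1⟩)

theorem eq_of_stepToward (hT : T.IsTree) {p q q' z : W} (h : T.StepToward p q z)
    (h' : T.StepToward p q' z) : q = q' := by
  have key : ∀ {r : W}, T.StepToward p r z →
      ∃ w : T.Walk p z, w.IsPath ∧ w.snd = r := by
    intro r hr
    obtain ⟨w, hw⟩ := hT.connected.exists_walk_length_eq_dist r z
    refine ⟨Walk.cons hr.adj w, Walk.isPath_of_length_eq_dist _ ?_, by simp⟩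
    simp [hw, hr.dist_eq]
  obtain ⟨w, hw, rfl⟩ := key h
  obtain ⟨w', hw', rfl⟩ := key h'
  have := (hT.isAcyclic.subsingleton_path p z).elim ⟨w, hw⟩ ⟨w', hw'⟩
  rw [Subtype.mk.injEq] at this
  rw [this]

theorem stepToward_of_adj (hT : T.IsTree) {p q z z' : W} (h : T.StepToward p q z)
    (hz : T.Adj z z') (hne : z' ≠ p) : T.StepToward p q z' := by
  rcases hT.stepToward_or h.adj z' with h1 | h1
  · exact h1
  exfalso
  obtain ⟨r, hr⟩ := hT.connected.exists_stepToward hne.symm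
  have e1 := h.dist_eq
  have e2 := h1.dist_eq
  have e3 := hr.dist_eq
  have e4 := hT.connected.dist_triangle (u := r) (v := z') (w := z)
  have e5 := hT.connected.dist_triangle (u := q) (v := z) (w := z')
  have e6 := dist_eq_one_iff_adj.mpr hz
  have e7 := dist_eq_one_iff_adj.mpr hz.symm
  rcases hT.stepToward_or hr.adj z with h2 | h2
  · have := hT.eq_of_stepToward h h2
    subst this
    omega
  · have := h2.dist_eq
    omega

theorem stepToward_of_dist_lt (hT : T.IsTree) {p q z z' : W} (h : T.StepToward p q z)
    (hd : T.dist z z' < T.dist p z) : T.StepToward p q z' := by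
  induction hn : T.dist z z' generalizing z with
  | zero => rwa [← hT.connected.dist_eq_zero_iff.mp hn]
  | succ n ih =>
    have hne : z ≠ z' := by
      rintro rfl
      simp at hn
    obtain ⟨r, hr⟩ := hT.connected.exists_stepToward hne
    have e1 := hr.dist_eq
    have e2 := hT.connected.dist_triangle (u := p) (v := r) (w := z)
    have e3 := dist_eq_one_iff_adj.mpr hr.adj
    have e4 := dist_eq_one_iff_adj.mpr hr.adj.symm
    have hrp : r ≠ p := by
      rintro rfl
      omega
    exact ih (hT.stepToward_of_adj h hr.adj hrp) (by omega) (by omega)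

theorem dist_eq_of_stepToward_of_not (hT : T.IsTree) {a c d z : W} (hz : T.StepToward c d z)
    (ha : ¬ T.StepToward c d a) : T.dist a z = T.dist a c + 1 + T.dist d z := by
  induction hn : T.dist a z generalizing a with
  | zero => exact absurd (hT.connected.dist_eq_zero_iff.mp hn ▸ hz) ha
  | succ n ih =>
    by_cases hac : a = c
    · subst hac
      have := hz.dist_eq
      simp
      omega
    have hne : a ≠ z := by
      rintro rfl
      exact ha hz
    obtain ⟨r, hr⟩ := hT.connected.exists_stepToward hne
    have e1 := hr.dist_eq
    have h1 := ih (a := r) (fun h => ha (hT.stepToward_of_adj h hr.adj.symm hac)) (by omega)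
    have e2 := hT.connected.dist_triangle (u := a) (v := r) (w := c)
    have e3 := dist_eq_one_iff_adj.mpr hr.adj
    have e4 := hT.connected.dist_triangle (u := a) (v := c) (w := z)
    have e5 := hz.dist_eq
    omega

/-- A sequence with bounded steps that leaves every ball converges to an end of the tree:
from each vertex there is a neighbour which is eventually one step closer to the sequence. -/
theorem exists_eventually_stepToward (hT : T.IsTree) {z : ℕ → W} {D : ℕ}
    (hD : ∀ n, T.dist (z n) (z (n + 1)) ≤ D)
    (hinf : ∀ p B, ∃ N, ∀ n ≥ N, B < T.dist p (z n)) (p : W) :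
    ∃ q, ∃ N, ∀ n ≥ N, T.StepToward p q (z n) := by
  obtain ⟨N, hN⟩ := hinf p D
  have hne : p ≠ z N := by
    intro h
    have := hN N le_rfl
    rw [← h] at this
    simp at this
  obtain ⟨q, hq⟩ := hT.connected.exists_stepToward hne
  refine ⟨q, N, fun n hn => ?_⟩
  induction n, hn using Nat.le_induction with
  | base => exact hq
  | succ n hn ih => exact hT.stepToward_of_dist_lt ih ((hD n).trans_lt (hN n hn))

end IsTree

end SimpleGraph

section TreeAction

open SimpleGraph
open scoped commutatorElement

variable {G W : Type} [Group G] {T : SimpleGraph W} {φ : G →* Equiv.Perm W}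

theorem PreservesAdj.dist_map_le (hadj : PreservesAdj T φ) (hT : T.Connected) (g : G) (p q : W) :
    T.dist (φ g p) (φ g q) ≤ T.dist p q := by
  obtain ⟨w, hw⟩ := hT.exists_walk_length_eq_dist p q
  let F : T →g T := ⟨φ g, fun h => hadj g _ _ h⟩
  have h := dist_le (w.map F)
  rwa [Walk.length_map, hw] at h

theorem PreservesAdj.dist_map (hadj : PreservesAdj T φ) (hT : T.Connected) (g : G) (p q : W) :
    T.dist (φ g p) (φ g q) = T.dist p q := by
  refine (hadj.dist_map_le hT g p q).antisymm ?_
  simpa using hadj.dist_map_le hT g⁻¹ (φ g p) (φ g q)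

theorem PreservesAdj.stepToward_map (hadj : PreservesAdj T φ) (hT : T.Connected) (g : G)
    {p q z : W} (h : T.StepToward p q z) : T.StepToward (φ g p) (φ g q) (φ g z) :=
  ⟨hadj g _ _ h.adj, by simpa [hadj.dist_map hT] using h.dist_eq⟩

/-- A hyperbolic element moves some vertex linearly far away under iteration. -/
theorem exists_le_dist_pow (hT : T.IsTree) (hadj : PreservesAdj T φ) (hni : NoInversions T φ)
    {g : G} (hg : ¬ Elliptic φ g) : ∃ x, ∀ n, n ≤ T.dist x (φ (g ^ n) x) := by
  have hc := hT.connected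
  have : Nonempty W := hc.nonempty
  have hgx : ∀ x, x ≠ φ g x := fun x h => hg ⟨x, h.symm⟩
  obtain ⟨x, hx⟩ : ∃ x, ∀ y, T.dist x (φ g x) ≤ T.dist y (φ g y) :=
    ⟨_, fun y => Function.argmin_le (fun x => T.dist x (φ g x)) y⟩
  obtain ⟨y, hy⟩ := hc.exists_stepToward (hgx x)
  have hback : ¬ T.StepToward (φ g x) (φ g y) x := by
    intro h
    have e1 := h.dist_eq
    have e2 := hy.dist_eq
    rw [SimpleGraph.dist_comm, SimpleGraph.dist_comm (v := x)] at e1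
    by_cases hyx : φ g y = x
    · rw [hyx, SimpleGraph.dist_self] at e1
      have : y = φ g x := hc.dist_eq_zero_iff.mp (by omega)
      exact hni g x y hy.adj ⟨this.symm, hyx⟩
    · have e3 := (hT.stepToward_of_adj hy h.adj hyx).dist_eq
      have := hx y
      omega
  have hback' : ¬ T.StepToward (φ g x) (φ g y) y := fun h =>
    hback (hT.stepToward_of_adj h hy.adj.symm (hgx x))
  have hpow : ∀ n, φ (g ^ (n + 1)) x = φ g (φ (g ^ n) x) := by
    intro n
    rw [pow_succ', map_mul, Equiv.Perm.mul_apply]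
  have hpos := hc.pos_dist_of_ne (hgx x)
  have key : ∀ n, T.StepToward x y (φ (g ^ (n + 1)) x) ∧
      n + 1 ≤ T.dist x (φ (g ^ (n + 1)) x) := by
    intro n
    induction n with
    | zero => simpa using ⟨hy, hpos⟩
    | succ n ih =>
      have hs := hadj.stepToward_map hc g ih.1
      rw [← hpow] at hs
      have e1 := hT.dist_eq_of_stepToward_of_not hs hback
      have e2 := hT.dist_eq_of_stepToward_of_not hs hback'
      have e3 := hy.dist_eq
      have e4 := hs.dist_eq
      have e5 := hadj.dist_map hc g x (φ (g ^ (n + 1)) x)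
      rw [← hpow] at e5
      exact ⟨⟨hy.adj, by omega⟩, by omega⟩
  refine ⟨x, fun n => ?_⟩
  cases n with
  | zero => simp
  | succ n => exact (key n).2

/-- The centralizer of a hyperbolic element commutes with a map moving every vertex one step
towards the attracting end of that element. -/
theorem exists_equivariant_step (hT : T.IsTree) (hadj : PreservesAdj T φ)
    (hni : NoInversions T φ) {g : G} (hg : ¬ Elliptic φ g) :
    ∃ f : W → W, (∀ p, T.Adj p (f p)) ∧
      (∀ c, Commute c g → ∀ p, f (φ c p) = φ c (f p)) ∧
      ∀ p q, ∃ m n, f^[m] p = f^[n] q := by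
  have hc := hT.connected
  obtain ⟨x, hx⟩ := exists_le_dist_pow hT hadj hni hg
  set z : ℕ → W := fun n => φ (g ^ n) x with hz
  have hD : ∀ n, T.dist (z n) (z (n + 1)) ≤ T.dist x (φ g x) := by
    intro n
    simp only [hz]
    rw [pow_succ, map_mul, Equiv.Perm.mul_apply, hadj.dist_map hc]
  have hinf : ∀ p B, ∃ N, ∀ n ≥ N, B < T.dist p (z n) := by
    intro p B
    refine ⟨T.dist x p + B + 1, fun n hn => ?_⟩
    have h1 : n ≤ T.dist x (z n) := hx n
    have h2 := hc.dist_triangle (u := x) (v := p) (w := z n)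
    omega
  choose f N hf using hT.exists_eventually_stepToward hD hinf
  have huniq : ∀ {p q M}, (∀ n ≥ M, T.StepToward p q (z n)) → f p = q := by
    intro p q M h
    exact hT.eq_of_stepToward (hf p _ (le_max_left (N p) M)) (h _ (le_max_right _ _))
  refine ⟨f, fun p => (hf p _ le_rfl).adj, fun c hcg p => ?_, fun p q => ?_⟩
  · obtain ⟨M, hM⟩ := hinf p (T.dist (φ c x) x)
    refine huniq (M := max M (N p)) fun n hn => ?_
    have h1 := hadj.stepToward_map hc c (hf p n (le_of_max_le_right hn))
    have h2 : φ c (z n) = φ (g ^ n) (φ c x) := by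
      simp only [hz]
      rw [← Equiv.Perm.mul_apply, ← Equiv.Perm.mul_apply, ← map_mul, ← map_mul,
        (hcg.pow_right n).eq]
    have h3 : T.dist (φ c (z n)) (z n) = T.dist (φ c x) x := by
      rw [h2]
      exact hadj.dist_map hc _ _ _
    refine hT.stepToward_of_dist_lt h1 ?_
    rw [h3, hadj.dist_map hc]
    exact hM n (le_of_max_le_left hn)
  · obtain ⟨w⟩ := hc.preconnected p q
    induction w with
    | nil => exact ⟨0, 0, rfl⟩
    | @cons p r q hpr w ih =>
      obtain ⟨m, n, h⟩ := ih
      have hpr' : f p = r ∨ f r = p := by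
        have hp := hf p _ (le_max_left (N p) (N r))
        have hr := hf r _ (le_max_right (N p) (N r))
        exact (hT.stepToward_or hpr _).imp (hT.eq_of_stepToward hp) (hT.eq_of_stepToward hr)
      rcases hpr' with h1 | h1
      · refine ⟨m + 1, n, ?_⟩
        rw [Function.iterate_succ_apply, h1, h]
      · refine ⟨m, n + 1, ?_⟩
        rw [Function.iterate_succ_apply', ← h, ← Function.iterate_succ_apply' f m r,
          Function.iterate_succ_apply, h1]

/-- If `f` commutes with `a` and `b` and any two orbits of `f` merge, then the commutator of
`a` and `b` fixes all points far along every orbit of `f`. -/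
theorem exists_commutator_fixes_iterate {f : W → W} {a b : G}
    (ha : ∀ p, f (φ a p) = φ a (f p)) (hb : ∀ p, f (φ b p) = φ b (f p))
    (hmerge : ∀ p q, ∃ m n, f^[m] p = f^[n] q) (x : W) :
    ∃ N, ∀ n ≥ N, φ ⁅a, b⁆ (f^[n] x) = f^[n] x := by
  have ha' : ∀ n p, f^[n] (φ a p) = φ a (f^[n] p) := fun n =>
    Function.Commute.iterate_left (g := φ a) ha n
  have hb' : ∀ n p, f^[n] (φ b p) = φ b (f^[n] p) := fun n =>
    Function.Commute.iterate_left (g := φ b) hb n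
  obtain ⟨y, rfl⟩ : ∃ y, φ b (φ a y) = x := ⟨φ a⁻¹ (φ b⁻¹ x), by simp⟩
  obtain ⟨m₁, n₁, h₁⟩ := hmerge y (φ a y)
  obtain ⟨m₂, n₂, h₂⟩ := hmerge y (φ b y)
  have hab : f^[n₁ + n₂] (φ a (φ b y)) = f^[m₁ + m₂] y := by
    rw [Function.iterate_add_apply, ha', ← h₂, ← ha', ← Function.iterate_add_apply,
      Nat.add_comm, Function.iterate_add_apply, ← h₁, ← Function.iterate_add_apply,
      Nat.add_comm]
  have hba : f^[n₁ + n₂] (φ b (φ a y)) = f^[m₁ + m₂] y := by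
    rw [Nat.add_comm n₁, Function.iterate_add_apply, hb', ← h₁, ← hb',
      ← Function.iterate_add_apply, Nat.add_comm, Function.iterate_add_apply, ← h₂,
      ← Function.iterate_add_apply]
  refine ⟨n₁ + n₂, fun n hn => ?_⟩
  obtain ⟨k, rfl⟩ := Nat.exists_eq_add_of_le' hn
  have h : f^[k + (n₁ + n₂)] (φ a (φ b y)) = f^[k + (n₁ + n₂)] (φ b (φ a y)) := by
    rw [Function.iterate_add_apply, hab, ← hba, ← Function.iterate_add_apply]
  conv_rhs => rw [← h]
  simp [commutatorElement_def, ha', hb']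

/-- If edge stabilizers are abelian, then commutators of elements centralizing a hyperbolic
element commute with each other. -/
theorem AbelianEdgeStabilizers.commute_commutators (hT : T.IsTree) (hadj : PreservesAdj T φ)
    (hni : NoInversions T φ) (hab : AbelianEdgeStabilizers T φ) {g : G} (hg : ¬ Elliptic φ g)
    {a b c d : G} (ha : Commute a g) (hb : Commute b g) (hc : Commute c g) (hd : Commute d g) :
    Commute ⁅a, b⁆ ⁅c, d⁆ := by
  obtain ⟨f, hf, hequiv, hmerge⟩ := exists_equivariant_step hT hadj hni hg
  obtain ⟨x⟩ := hT.connected.nonempty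
  obtain ⟨M, hM⟩ := exists_commutator_fixes_iterate (hequiv a ha) (hequiv b hb) hmerge x
  obtain ⟨N, hN⟩ := exists_commutator_fixes_iterate (hequiv c hc) (hequiv d hd) hmerge x
  have hedge := hf (f^[max M N] x)
  rw [← Function.iterate_succ_apply' f] at hedge
  exact hab _ _ hedge _ _ (hM _ (le_max_left _ _)) (hM _ ((le_max_left _ _).trans (Nat.le_succ _)))
    (hN _ (le_max_right _ _)) (hN _ ((le_max_right _ _).trans (Nat.le_succ _)))

end TreeAction

namespace RAAG

open scoped commutatorElement

variable {V : Type} {Γ : SimpleGraph V}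

theorem commute_gen {u v : V} (h : Γ.Adj u v) : Commute (gen Γ u) (gen Γ v) := by
  have := PresentedGroup.one_of_mem (rels := raagRels Γ) ⟨u, v, h, rfl⟩
  rw [map_mul, map_mul, map_mul, map_inv, map_inv] at this
  exact mul_inv_eq_iff_eq_mul.mp (mul_inv_eq_one.mp this)

/-- Distinct non-adjacent generators can be sent to arbitrary elements of a group. -/
theorem exists_hom_of_not_adj {H : Type*} [Group H] {v w : V} (hne : v ≠ w) (h : ¬ Γ.Adj v w)
    (a b : H) : ∃ ψ : RAAG Γ →* H, ψ (gen Γ v) = a ∧ ψ (gen Γ w) = b := by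
  classical
  let F : V → H := fun x => if x = v then a else if x = w then b else 1
  have hF : ∀ r ∈ raagRels Γ, FreeGroup.lift F r = 1 := by
    rintro _ ⟨x, y, hxy, rfl⟩
    simp only [map_mul, map_inv, FreeGroup.lift_apply_of, F]
    have := hxy.ne
    split_ifs <;> subst_vars <;> simp_all [hxy.symm]
  refine ⟨PresentedGroup.toGroup hF, ?_, ?_⟩
  · exact (PresentedGroup.toGroup.of hF).trans (by simp [F])
  · exact (PresentedGroup.toGroup.of hF).trans (by simp [F, hne.symm])

theorem not_commute_commutators {v w : V} (hne : v ≠ w) (h : ¬ Γ.Adj v w) :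
    ¬ Commute ⁅gen Γ v, gen Γ w⁆ ⁅gen Γ v, gen Γ w ^ 2⁆ := by
  obtain ⟨ψ, hv, hw⟩ := exists_hom_of_not_adj (H := Equiv.Perm (Fin 4)) hne h
    (Equiv.swap 0 1) (finRotate 4)
  intro hcomm
  have := hcomm.map ψ
  rw [map_commutatorElement, map_commutatorElement, map_pow, hv, hw] at this
  revert this
  unfold Commute SemiconjBy
  decide

end RAAG

/-- If `A(Γ)` acts without inversions on a simplicial tree with abelian edge
stabilizers, `v ∈ V(Γ)` acts hyperbolically and `Γ ∖ star(v)` is nonempty, then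
the elliptic vertices of `link(v)` separate `v` from `Γ ∖ star(v)`: every path in
`Γ` from `v` to a vertex outside `star(v)` passes through an elliptic vertex of
`link(v)`. -/
theorem elliptic_link_separates {V W : Type} [Finite V]
    (Γ : SimpleGraph V) (T : SimpleGraph W) (hT : T.IsTree)
    (φ : RAAG Γ →* Equiv.Perm W)
    (hadj : PreservesAdj T φ) (hni : NoInversions T φ)
    (hab : AbelianEdgeStabilizers T φ)
    (v : V) (hv : ¬ Elliptic φ (RAAG.gen Γ v))
    (hne : ∃ w : V, w ∉ insert v (Γ.neighborSet v)) :
    ∀ w : V, w ∉ insert v (Γ.neighborSet v) → ∀ p : Γ.Walk v w,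
      ∃ u ∈ p.support, u ∈ Γ.neighborSet v ∧ Elliptic φ (RAAG.gen Γ u) := by
  intro w hw p
  obtain ⟨d, hd, hd₁, hd₂⟩ :=
    p.exists_boundary_dart (insert v (Γ.neighborSet v)) (Set.mem_insert _ _) hw
  have hd₃ : d.fst ∈ Γ.neighborSet v := by
    refine hd₁.resolve_left fun h => hd₂ (Or.inr ?_)
    rw [SimpleGraph.mem_neighborSet, ← h]
    exact d.adj
  refine ⟨d.fst, p.dart_fst_mem_support_of_mem_darts hd, hd₃, ?_⟩
  by_contra hell
  have hne' : v ≠ d.snd := fun h => hd₂ (Or.inl h.symm)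
  have hnadj : ¬ Γ.Adj v d.snd := fun h => hd₂ (Or.inr h)
  have h₁ := RAAG.commute_gen hd₃
  have h₂ := RAAG.commute_gen d.adj.symm
  exact RAAG.not_commute_commutators hne' hnadj
    (hab.commute_commutators hT hadj hni hell h₁ h₂ h₁ (h₂.pow_left 2))
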